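/- arXiv:2601.08535 — 2 statements merged into one kernel-verified Lean document; each statement's English description precedes it below -/
import Mathlib

section
/- Fix an integer l ≥ 0 and suppose c_l > 0 is a constant such that for every integer m ≥ l + 1, every alphabet size, and every probability vector q, the Good-Turing estimate ((l+1)/max(1, m−l))·φ_{l+1} computed from m i.i.d. samples from q satisfies E[(M_l − ((l+1)/max(1, m−l))·φ_{l+1})²] ≤ c_l/m. Let π be a probability vector on [d], let A ⊆ [d] with π_A = Σ_{i∈A} π_i > 0, and suppose l ≤ (n/2)·π_A. Then, with M_l^A = Σ_{i∈A} (π_i/π_A)·1[N_i = l] and M̂_l^A = ((l+1)/max(1, N_A − l))·φ_{l+1}^A, one has E[(M_l^A − M̂_l^A)²] ≤ (8l + 2c_l)/(n·π_A). -/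
open Finset

/-- `π` is a probability vector on `Fin d`: nonnegative coordinates summing to 1. -/
def IsProbVec {d : ℕ} (π : Fin d → ℝ) : Prop :=
  (∀ i, 0 ≤ π i) ∧ ∑ i, π i = 1

/-- Probability of observing the sample sequence `x` under i.i.d. draws from `π`
(the `n`-fold product law of `π`). -/
noncomputable def prodProb {d n : ℕ} (π : Fin d → ℝ) (x : Fin n → Fin d) : ℝ :=
  ∏ k, π (x k)

/-- Expectation of `f (X^n)` where `X^n = (X_1,…,X_n)` are i.i.d. samples from `π`. -/
noncomputable def expect {d n : ℕ} (π : Fin d → ℝ) (f : (Fin n → Fin d) → ℝ) : ℝ :=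
  ∑ x : Fin n → Fin d, prodProb π x * f x

/-- `N_i`: the number of occurrences of symbol `i` in the sample `x`. -/
def cnt {d n : ℕ} (x : Fin n → Fin d) (i : Fin d) : ℕ :=
  (Finset.univ.filter (fun k => x k = i)).card

/-- The empirical estimator `π^em(x) i = N_i / n`. -/
noncomputable def empDist {d n : ℕ} (x : Fin n → Fin d) : Fin d → ℝ :=
  fun i => (cnt x i : ℝ) / n

/-- Squared Euclidean (ℓ2) distance `‖u - v‖²`. -/
noncomputable def sqDist {d : ℕ} (u v : Fin d → ℝ) : ℝ := ∑ i, (u i - v i) ^ 2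

/-- Euclidean (ℓ2) norm. -/
noncomputable def l2norm {d : ℕ} (u : Fin d → ℝ) : ℝ := Real.sqrt (∑ i, u i ^ 2)

/-- `M_l`: the total q-mass of symbols appearing exactly l times in the sample y. -/
noncomputable def massL {d n : ℕ} (q : Fin d → ℝ) (l : ℕ) (y : Fin n → Fin d) : ℝ :=
  ∑ i, if cnt y i = l then q i else 0

/-- `φ_l`: the number of symbols appearing exactly l times in the sample y. -/
def phiL {d n : ℕ} (l : ℕ) (y : Fin n → Fin d) : ℕ :=
  (Finset.univ.filter (fun i : Fin d => cnt y i = l)).card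

/-- `N_A`: the number of samples falling in the set A. -/
def cntSet {d n : ℕ} (x : Fin n → Fin d) (A : Finset (Fin d)) : ℕ :=
  (Finset.univ.filter (fun k => x k ∈ A)).card

/-- `φ_l^A`: the number of symbols of A appearing exactly l times in the sample x. -/
def phiLA {d n : ℕ} (l : ℕ) (A : Finset (Fin d)) (x : Fin n → Fin d) : ℕ :=
  (A.filter (fun i => cnt x i = l)).card

/-- `M_l^A`: the mass, under the conditional distribution (π_i/π_A) on A, of symbols of A
appearing exactly l times in the sample x. -/
noncomputable def massLA {d n : ℕ} (π : Fin d → ℝ) (l : ℕ) (A : Finset (Fin d))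
    (x : Fin n → Fin d) : ℝ :=
  ∑ i ∈ A, if cnt x i = l then π i / (∑ j ∈ A, π j) else 0

lemma aux_sum_prod {ι : Type*} [Fintype ι] [DecidableEq ι] {d : ℕ} (b : Fin d → ℝ) :
    ∑ z : ι → Fin d, ∏ k, b (z k) = (∑ i, b i) ^ Fintype.card ι := by
  have := Finset.sum_prod_piFinset (ι := ι) (Finset.univ : Finset (Fin d)) (fun _ j => b j)
  simpa using this

lemma aux_split {d n : ℕ} (S : Finset (Fin n)) (a b : Fin d → ℝ)
    (G : (Fin S.card → Fin d) → ℝ) :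
    ∑ x : Fin n → Fin d, (∏ k, if k ∈ S then a (x k) else b (x k)) *
      G (fun j => x (S.equivFin.symm j)) =
    (∑ i, b i) ^ (n - S.card) * ∑ y : Fin S.card → Fin d, (∏ k, a (y k)) * G y := by
  classical
  rw [← Equiv.sum_comp (Equiv.piEquivPiSubtypeProd (fun k => k ∈ S) (fun _ => Fin d)).symm,
    Fintype.sum_prod_type]
  have key : ∀ (y : {k // k ∈ S} → Fin d) (z : {k // ¬ k ∈ S} → Fin d),
      (∏ k, if k ∈ S then
          a ((Equiv.piEquivPiSubtypeProd (fun k => k ∈ S) (fun _ => Fin d)).symm (y, z) k)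
        else b ((Equiv.piEquivPiSubtypeProd (fun k => k ∈ S) (fun _ => Fin d)).symm (y, z) k)) *
      G (fun j => (Equiv.piEquivPiSubtypeProd (fun k => k ∈ S) (fun _ => Fin d)).symm (y, z)
        (S.equivFin.symm j)) =
      (∏ k, b (z k)) * ((∏ k, a (y k)) * G (fun j => y (S.equivFin.symm j))) := by
    intro y z
    have h1 : (∏ k : {k // k ∈ S}, if (k : Fin n) ∈ S then
          a ((Equiv.piEquivPiSubtypeProd (fun k => k ∈ S) (fun _ => Fin d)).symm (y, z) k)
        else b ((Equiv.piEquivPiSubtypeProd (fun k => k ∈ S) (fun _ => Fin d)).symm (y, z) k))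
        = ∏ k, a (y k) := by
      refine Finset.prod_congr rfl fun k _ => ?_
      simp [Equiv.piEquivPiSubtypeProd]
    have h2 : (∏ k : {k // ¬ k ∈ S}, if (k : Fin n) ∈ S then
          a ((Equiv.piEquivPiSubtypeProd (fun k => k ∈ S) (fun _ => Fin d)).symm (y, z) k)
        else b ((Equiv.piEquivPiSubtypeProd (fun k => k ∈ S) (fun _ => Fin d)).symm (y, z) k))
        = ∏ k, b (z k) := by
      refine Finset.prod_congr rfl fun k _ => ?_
      have := k.2
      simp [Equiv.piEquivPiSubtypeProd, this]
    have h3 : (fun j => (Equiv.piEquivPiSubtypeProd (fun k => k ∈ S) (fun _ => Fin d)).symm (y, z)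
        (S.equivFin.symm j)) = (fun j => y (S.equivFin.symm j)) := by
      funext j
      simp [Equiv.piEquivPiSubtypeProd]
    have h12 : (∏ k, if k ∈ S then
          a ((Equiv.piEquivPiSubtypeProd (fun k => k ∈ S) (fun _ => Fin d)).symm (y, z) k)
        else b ((Equiv.piEquivPiSubtypeProd (fun k => k ∈ S) (fun _ => Fin d)).symm (y, z) k)) =
        (∏ k, a (y k)) * ∏ k, b (z k) := by
      rw [← Fintype.prod_subtype_mul_prod_subtype (fun k => k ∈ S), ← h1, ← h2]
      congr!
    rw [h12, h3]; ring
  simp_rw [key, ← Finset.sum_mul, aux_sum_prod, ← Finset.mul_sum]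
  have hcard : Fintype.card {k // ¬ k ∈ S} = n - S.card := by
    rw [Fintype.card_subtype_compl]; simp
  rw [hcard]
  congr 1
  rw [← Equiv.sum_comp (Equiv.arrowCongr S.equivFin (Equiv.refl (Fin d)))]
  refine Finset.sum_congr rfl fun y _ => ?_
  congr 1
  rw [← Equiv.prod_comp S.equivFin]
  simp [Equiv.arrowCongr]

lemma aux_cond {d n : ℕ} (π : Fin d → ℝ) (hπ : IsProbVec π) (A : Finset (Fin d))
    (hA : 0 < ∑ i ∈ A, π i) (S : Finset (Fin n)) (F : (Fin n → Fin d) → ℝ)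
    (G : (Fin S.card → Fin d) → ℝ)
    (hF : ∀ x, univ.filter (fun k => x k ∈ A) = S → F x = G (fun j => x (S.equivFin.symm j))) :
    ∑ x with univ.filter (fun k => x k ∈ A) = S, prodProb π x * F x =
      (∑ i ∈ A, π i) ^ S.card * (1 - ∑ i ∈ A, π i) ^ (n - S.card) *
        expect (fun i => if i ∈ A then π i / ∑ j ∈ A, π j else 0) G := by
  classical
  set p := ∑ i ∈ A, π i with hp
  have hsplit := aux_split S (fun i => if i ∈ A then π i else 0)
    (fun i => if i ∈ A then 0 else π i) G
  have hb : ∑ i, (if i ∈ A then 0 else π i) = 1 - p := by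
    rw [← hπ.2, hp, eq_sub_iff_add_eq, ← Finset.sum_filter_add_sum_filter_not univ (fun i => i ∈ A) π]
    rw [Finset.sum_ite]
    simp [add_comm]
  rw [hb] at hsplit
  rw [Finset.sum_filter]
  trans ∑ x : Fin n → Fin d, (∏ k, if k ∈ S then (if x k ∈ A then π (x k) else 0)
      else (if x k ∈ A then 0 else π (x k))) * G (fun j => x (S.equivFin.symm j))
  · refine Finset.sum_congr rfl fun x _ => ?_
    split_ifs with h
    · rw [hF x h]
      congr 1
      unfold prodProb
      refine Finset.prod_congr rfl fun k _ => ?_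
      have : k ∈ S ↔ x k ∈ A := by rw [← h]; simp
      by_cases hk : x k ∈ A <;> simp [this, hk]
    · have : ∃ k, ¬ (k ∈ S ↔ x k ∈ A) := by
        by_contra! hcon
        apply h
        ext k
        simp [hcon k]
      obtain ⟨k, hk⟩ := this
      rw [Finset.prod_eq_zero (Finset.mem_univ k), zero_mul]
      by_cases h1 : k ∈ S <;> by_cases h2 : x k ∈ A <;> simp_all
  · rw [hsplit]
    unfold _root_.expect prodProb
    rw [mul_comm (p ^ _), mul_assoc]
    congr 1
    rw [Finset.mul_sum]
    refine Finset.sum_congr rfl fun y _ => ?_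
    rw [← mul_assoc]
    congr 1
    have : p ^ S.card = ∏ _k : Fin S.card, p := by simp
    rw [this, ← Finset.prod_mul_distrib]
    refine Finset.prod_congr rfl fun k _ => ?_
    by_cases hk : y k ∈ A
    · simp only [hk, if_true]
      field_simp
    · simp [hk]

lemma aux_cnt {d n : ℕ} (A : Finset (Fin d)) (S : Finset (Fin n)) (x : Fin n → Fin d)
    (h : univ.filter (fun k => x k ∈ A) = S) (i : Fin d) (hi : i ∈ A) :
    cnt (fun j => x (S.equivFin.symm j)) i = cnt x i := by
  unfold cnt
  refine Finset.card_bij (fun j _ => (S.equivFin.symm j : Fin n)) ?_ ?_ ?_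
  · intro j hj; simpa using hj
  · intro j _ j' _ hjj
    exact S.equivFin.symm.injective (Subtype.ext hjj)
  · intro k hk
    have hk' : x k = i := by simpa using hk
    have hkS : k ∈ S := by rw [← h]; simp [hk', hi]
    exact ⟨S.equivFin ⟨k, hkS⟩, by simp [hk'], by simp⟩

lemma aux_cnt0 {d n : ℕ} (A : Finset (Fin d)) (S : Finset (Fin n)) (x : Fin n → Fin d)
    (h : univ.filter (fun k => x k ∈ A) = S) (i : Fin d) (hi : i ∉ A) :
    cnt (fun j => x (S.equivFin.symm j)) i = 0 := by
  unfold cnt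
  rw [Finset.card_eq_zero, Finset.filter_eq_empty_iff]
  intro j _ hj
  have : x (S.equivFin.symm j) ∈ A := by
    have h2 : ∀ k, k ∈ S → x k ∈ A := by intro k hk; rw [← h] at hk; simpa using hk
    exact h2 _ (S.equivFin.symm j).2
  exact hi (hj ▸ this)

lemma aux_cnt_le {d n : ℕ} (x : Fin n → Fin d) (i : Fin d) : cnt x i ≤ n := by
  unfold cnt
  exact (Finset.card_filter_le _ _).trans (by simp)

lemma aux_expect_le_one {d m : ℕ} (q : Fin d → ℝ) (hq : IsProbVec q)
    (f : (Fin m → Fin d) → ℝ) (hf : ∀ y, f y ≤ 1) : expect q f ≤ 1 := by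
  have h1 : ∑ y : Fin m → Fin d, prodProb q y = 1 := by
    unfold prodProb; rw [aux_sum_prod, hq.2, one_pow]
  rw [← h1]
  unfold _root_.expect
  refine Finset.sum_le_sum fun y _ => ?_
  have : 0 ≤ prodProb q y := Finset.prod_nonneg fun k _ => hq.1 _
  nlinarith [hf y]

lemma aux_var (n : ℕ) (p : ℝ) :
    ∑ m ∈ range (n + 1), (n.choose m : ℝ) * (p ^ m * (1 - p) ^ (n - m)) * (n * p - m) ^ 2 =
      n * p * (1 - p) := by
  have := congrArg (Polynomial.eval p) (bernsteinPolynomial.variance ℝ n)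
  simp only [bernsteinPolynomial, Polynomial.eval_finsetSum, Polynomial.eval_mul,
    Polynomial.eval_pow, Polynomial.eval_sub, nsmul_eq_mul, Polynomial.eval_natCast,
    Polynomial.eval_X, Polynomial.eval_one] at this
  rw [← this]
  exact Finset.sum_congr rfl fun m _ => by ring

lemma aux_inv (n : ℕ) (p : ℝ) (hp : 0 < p) (hp1 : p ≤ 1) :
    ∑ m ∈ range (n + 1), (n.choose m : ℝ) * (p ^ m * (1 - p) ^ (n - m)) * (1 / ((m : ℝ) + 1)) ≤
      1 / ((n + 1) * p) := by
  have h := add_pow p (1 - p) (n + 1)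
  rw [add_sub_cancel, one_pow, Finset.sum_range_succ'] at h
  rw [le_div_iff₀ (by positivity), Finset.sum_mul]
  have h0 : 0 ≤ p ^ 0 * (1 - p) ^ (n + 1 - 0) * ((n + 1).choose 0 : ℝ) := by
    have : 0 ≤ 1 - p := by linarith
    positivity
  refine le_trans (le_of_eq ?_) (le_trans (le_add_of_nonneg_right h0) h.ge)
  refine Finset.sum_congr rfl fun m hm => ?_
  have hc : ((n : ℝ) + 1) * n.choose m = (n + 1).choose (m + 1) * (m + 1) := by
    exact_mod_cast Nat.add_one_mul_choose_eq n m
  have e : n + 1 - (m + 1) = n - m := by omega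
  rw [e]
  have hm0 : (m : ℝ) + 1 ≠ 0 := by positivity
  field_simp
  linear_combination (p ^ m * (1 - p) ^ (n - m) * p) * hc

/-- If the Good-Turing estimate has mean squared error at most c_l/m for every
sample size m ≥ l+1, every alphabet and every distribution q, then the restricted Good-Turing
estimate for a set A with π_A > 0 and l ≤ (n/2)·π_A satisfies
E[(M_l^A − M̂_l^A)²] ≤ (8l + 2c_l)/(n·π_A). -/
theorem stmt_16 {d n : ℕ} (hn : 1 ≤ n) (l : ℕ) (c : ℝ) (hc : 0 < c)
    (hGT : ∀ (m d' : ℕ) (q : Fin d' → ℝ), IsProbVec q → l + 1 ≤ m →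
      expect q (fun y : Fin m → Fin d' =>
          (massL q l y - ((l : ℝ) + 1) / max 1 ((m : ℝ) - l) * phiL (l + 1) y) ^ 2) ≤
        c / m)
    (π : Fin d → ℝ) (hπ : IsProbVec π)
    (A : Finset (Fin d)) (hApos : 0 < ∑ i ∈ A, π i)
    (hl : (l : ℝ) ≤ (n : ℝ) / 2 * ∑ i ∈ A, π i) :
    expect π (fun x : Fin n → Fin d =>
        (massLA π l A x -
          ((l : ℝ) + 1) / max 1 ((cntSet x A : ℝ) - l) * phiLA (l + 1) A x) ^ 2) ≤
      (8 * l + 2 * c) / ((n : ℝ) * ∑ i ∈ A, π i) := by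
  classical
  have hnR : (1 : ℝ) ≤ n := by exact_mod_cast hn
  have hp1 : ∑ i ∈ A, π i ≤ 1 := by
    rw [← hπ.2]
    exact Finset.sum_le_sum_of_subset_of_nonneg (Finset.subset_univ _) fun i _ _ => hπ.1 i
  have hq : IsProbVec (fun i => if i ∈ A then π i / ∑ j ∈ A, π j else 0) := by
    refine ⟨fun i => ?_, ?_⟩
    · dsimp only
      split_ifs
      · exact div_nonneg (hπ.1 i) hApos.le
      · exact le_rfl
    · rw [Finset.sum_ite_mem, Finset.univ_inter, ← Finset.sum_div, div_self hApos.ne']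
  have hc1 : l = 0 → 1 ≤ c := by
    rintro rfl
    have := hGT 1 1 (fun _ => 1) ⟨fun _ => zero_le_one, by simp⟩ (by norm_num)
    have hcnt : ∀ (y : Fin 1 → Fin 1) (i : Fin 1), cnt y i = 1 := by
      intro y i
      simp [cnt, Subsingleton.elim _ i]
    simpa [_root_.expect, prodProb, massL, phiL, hcnt] using this
  set p := ∑ i ∈ A, π i with hp
  set q : Fin d → ℝ := fun i => if i ∈ A then π i / p else 0 with hqdef
  have hnp : 0 < (n : ℝ) * p := by positivity
  have hbound : ∀ m : ℕ, expect q (fun y : Fin m → Fin d =>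
      (massL q l y - ((l : ℝ) + 1) / max 1 ((m : ℝ) - l) * phiL (l + 1) y) ^ 2) ≤
      2 * c * (1 / ((m : ℝ) + 1)) +
        (if l = 0 then 0 else 4 / ((n : ℝ) * p) ^ 2) * (n * p - m) ^ 2 := by
    intro m
    have hnn : 0 ≤ (if l = 0 then 0 else 4 / ((n : ℝ) * p) ^ 2) * (n * p - m) ^ 2 := by
      split_ifs <;> positivity
    by_cases hm : l + 1 ≤ m
    · refine (hGT m d q hq hm).trans ?_
      have hm1 : (1 : ℝ) ≤ m := by exact_mod_cast (by omega : 1 ≤ m)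
      have : c / m ≤ 2 * c * (1 / ((m : ℝ) + 1)) := by
        rw [mul_one_div, div_le_div_iff₀ (by linarith) (by linarith)]
        nlinarith
      linarith
    · have hle1 : expect q (fun y : Fin m → Fin d =>
        (massL q l y - ((l : ℝ) + 1) / max 1 ((m : ℝ) - l) * phiL (l + 1) y) ^ 2) ≤ 1 := by
        refine aux_expect_le_one q hq _ fun y => ?_
        have hphi : phiL (l + 1) y = 0 := by
          unfold phiL
          rw [Finset.card_eq_zero, Finset.filter_eq_empty_iff]
          intro i _ hi
          have := aux_cnt_le y i
          omega
        have h0 : 0 ≤ massL q l y := by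
          unfold massL
          refine Finset.sum_nonneg fun i _ => ?_
          split_ifs
          · exact hq.1 i
          · exact le_rfl
        have h1 : massL q l y ≤ 1 := by
          rw [← hq.2]
          unfold massL
          refine Finset.sum_le_sum fun i _ => ?_
          split_ifs
          · exact le_rfl
          · exact hq.1 i
        rw [hphi]
        simp only [Nat.cast_zero, mul_zero, sub_zero]
        exact pow_le_one₀ h0 h1
      refine hle1.trans ?_
      by_cases hl0 : l = 0
      · have hm0 : m = 0 := by omega
        have := hc1 hl0
        simp only [hl0, hm0]
        norm_num
        linarith
      · have hml : (m : ℝ) ≤ l := by exact_mod_cast (by omega : m ≤ l)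
        have h2 : 0 ≤ 2 * c * (1 / ((m : ℝ) + 1)) := by positivity
        rw [if_neg hl0]
        have h3 : 1 ≤ 4 / ((n : ℝ) * p) ^ 2 * (n * p - m) ^ 2 := by
          rw [div_mul_eq_mul_div, le_div_iff₀ (by positivity)]
          have : (n : ℝ) * p / 2 ≤ n * p - m := by linarith
          nlinarith
        linarith
  have hdecomp : expect π (fun x : Fin n → Fin d =>
        (massLA π l A x -
          ((l : ℝ) + 1) / max 1 ((cntSet x A : ℝ) - l) * phiLA (l + 1) A x) ^ 2) =
      ∑ S ∈ (univ : Finset (Fin n)).powerset, p ^ S.card * (1 - p) ^ (n - S.card) *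
        expect q (fun y : Fin S.card → Fin d =>
      (massL q l y - ((l : ℝ) + 1) / max 1 ((S.card : ℝ) - l) * phiL (l + 1) y) ^ 2) := by
    unfold _root_.expect
    rw [← Finset.sum_fiberwise_of_maps_to (s := univ) (t := (univ : Finset (Fin n)).powerset)
      (g := fun x : Fin n → Fin d => univ.filter (fun k => x k ∈ A)) (by simp)]
    refine Finset.sum_congr rfl fun S _ => ?_
    refine aux_cond π hπ A hApos S _ _ fun x hx => ?_
    have e1 : massLA π l A x = massL q l (fun j => x (S.equivFin.symm j)) := by
      unfold massLA massL
      rw [← Finset.sum_subset (Finset.subset_univ A)]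
      · refine Finset.sum_congr rfl fun i hi => ?_
        rw [aux_cnt A S x hx i hi]
        simp [hqdef, hi, hp]
      · intro i _ hi
        simp [hqdef, hi]
    have e2 : phiLA (l + 1) A x = phiL (l + 1) (fun j => x (S.equivFin.symm j)) := by
      unfold phiLA phiL
      congr 1
      ext i
      simp only [Finset.mem_filter, Finset.mem_univ, true_and]
      by_cases hi : i ∈ A
      · rw [aux_cnt A S x hx i hi]; simp [hi]
      · rw [aux_cnt0 A S x hx i hi]; simp [hi]
    have e3 : cntSet x A = S.card := by unfold cntSet; rw [hx]
    rw [e1, e2, e3]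
  rw [hdecomp]
  clear_value q
  clear_value p
  have h1p : 0 ≤ 1 - p := by linarith
  calc _ ≤ ∑ S ∈ (univ : Finset (Fin n)).powerset, p ^ S.card * (1 - p) ^ (n - S.card) *
        (2 * c * (1 / ((S.card : ℝ) + 1)) +
        (if l = 0 then 0 else 4 / ((n : ℝ) * p) ^ 2) * (n * p - S.card) ^ 2) := by
        refine Finset.sum_le_sum fun S _ => ?_
        exact mul_le_mul_of_nonneg_left (hbound S.card) (by positivity)
    _ = 2 * c * ∑ m ∈ range (n + 1), (n.choose m : ℝ) * (p ^ m * (1 - p) ^ (n - m)) *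
          (1 / ((m : ℝ) + 1)) + (if l = 0 then 0 else 4 / ((n : ℝ) * p) ^ 2) *
        ∑ m ∈ range (n + 1), (n.choose m : ℝ) * (p ^ m * (1 - p) ^ (n - m)) * (n * p - m) ^ 2 := by
        rw [Finset.sum_powerset_apply_card (fun m : ℕ => p ^ m * (1 - p) ^ (n - m) *
          (2 * c * (1 / ((m : ℝ) + 1)) +
          (if l = 0 then 0 else 4 / ((n : ℝ) * p) ^ 2) * (n * p - m) ^ 2))]
        rw [Finset.mul_sum, Finset.mul_sum, ← Finset.sum_add_distrib, Finset.card_univ,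
          Fintype.card_fin]
        refine Finset.sum_congr rfl fun m _ => ?_
        rw [nsmul_eq_mul]
        ring
    _ ≤ 2 * c * (1 / (n * p)) + 8 * l / (n * p) := by
        rw [aux_var]
        refine add_le_add ?_ ?_
        · refine mul_le_mul_of_nonneg_left ((aux_inv n p hApos hp1).trans ?_) (by positivity)
          exact one_div_le_one_div_of_le hnp (by nlinarith)
        · by_cases hl0 : l = 0
          · simp [hl0]
          · rw [if_neg hl0]
            have hl1 : (1 : ℝ) ≤ l := by exact_mod_cast Nat.one_le_iff_ne_zero.mpr hl0
            have : 4 / ((n : ℝ) * p) ^ 2 * (n * p * (1 - p)) = 4 * (1 - p) / (n * p) := by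
              field_simp
            rw [this]
            exact div_le_div_of_nonneg_right (by linarith) hnp.le
    _ = _ := by ring
end

section
/- Fix an integer l ≥ 0 and suppose c_l > 0 is a constant such that for every integer m ≥ l + 1, every alphabet size, and every probability vector q, the Good-Turing estimate ((l+1)/max(1, m−l))·φ_{l+1} computed from m i.i.d. samples from q satisfies E[(M_l − ((l+1)/max(1, m−l))·φ_{l+1})²] ≤ c_l/m. Let π be a probability vector on [d] partitioned into nonempty sets A and B = [d]∖A with π_A > 0 and π_B > 0, and suppose l ≤ (n/2)·min(π_A, π_B). Define the two-level estimates π̂^(l,A) = ((l+1)/max(1, N_A − l))·φ_{l+1}^A/φ_l^A when φ_l^A > 0 (and set the corresponding error term to 0 when φ_l^A = 0), and similarly π̂^(l,B); define the conditional oracle values μ_A = M_l^A/φ_l^A and μ_B = M_l^B/φ_l^B. Then E[ φ_l^A·(μ_A − π̂^(l,A))² + φ_l^B·(μ_B − π̂^(l,B))² ] ≤ ((8l + 2c_l)/n)·( 1/π_A + 1/π_B ). -/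
open Finset

/-- The weighted squared deviation φ_l^A·(μ_A − π̂^(l,A))², where μ_A = M_l^A/φ_l^A is the
conditional oracle value and π̂^(l,A) = ((l+1)/max(1, N_A − l))·φ_{l+1}^A/φ_l^A is the two-level
Good-Turing estimate; the term is set to 0 when φ_l^A = 0. -/
noncomputable def twoLevelErr {d n : ℕ} (π : Fin d → ℝ) (l : ℕ) (A : Finset (Fin d))
    (x : Fin n → Fin d) : ℝ :=
  if phiLA l A x = 0 then 0
  else (phiLA l A x : ℝ) *
    (massLA π l A x / phiLA l A x -
      ((l : ℝ) + 1) / max 1 ((cntSet x A : ℝ) - l) * phiLA (l + 1) A x / phiLA l A x) ^ 2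

open Finset

lemma h_prodProb_nonneg {d n : ℕ} {q : Fin d → ℝ} (hq : IsProbVec q) (x : Fin n → Fin d) :
    0 ≤ prodProb q x := Finset.prod_nonneg fun k _ => hq.1 (x k)

lemma h_sum_prod {d : ℕ} {ι : Type*} [Fintype ι] [DecidableEq ι] (a : Fin d → ℝ) :
    ∑ x : ι → Fin d, ∏ k, a (x k) = (∑ i, a i) ^ Fintype.card ι := by
  have := Finset.prod_univ_sum (fun _ : ι => (univ : Finset (Fin d))) (fun _ i => a i)
  rw [Fintype.piFinset_univ] at this
  rw [← this, Finset.prod_const, Finset.card_univ]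

lemma h_c_ge {l : ℕ} {c : ℝ}
    (hGT : ∀ (m d' : ℕ) (q : Fin d' → ℝ), IsProbVec q → l + 1 ≤ m →
      expect q (fun y : Fin m → Fin d' =>
          (massL q l y - ((l : ℝ) + 1) / max 1 ((m : ℝ) - l) * phiL (l + 1) y) ^ 2) ≤
        c / m) : (l : ℝ) + 1 ≤ c := by
  have h := hGT (l + 1) 1 (fun _ => 1) ⟨fun _ => zero_le_one, by simp⟩ le_rfl
  have hc : ∀ (y : Fin (l+1) → Fin 1) i, cnt y i = l + 1 := by
    intro y i
    unfold cnt
    rw [Finset.filter_true_of_mem (fun k _ => Subsingleton.elim _ _)]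
    simp
  simp [_root_.expect, prodProb, massL, phiL, hc] at h
  have hl : (0:ℝ) ≤ l := Nat.cast_nonneg l
  rw [le_div_iff₀ (by positivity)] at h
  nlinarith [mul_nonneg hl hl, mul_nonneg (mul_nonneg hl hl) hl]

lemma h_cond {l : ℕ} {c : ℝ}
    (hGT : ∀ (m d' : ℕ) (q : Fin d' → ℝ), IsProbVec q → l + 1 ≤ m →
      expect q (fun y : Fin m → Fin d' =>
          (massL q l y - ((l : ℝ) + 1) / max 1 ((m : ℝ) - l) * phiL (l + 1) y) ^ 2) ≤
        c / m) (m d : ℕ) (q : Fin d → ℝ) (hq : IsProbVec q) :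
    expect q (fun y : Fin m → Fin d =>
          (massL q l y - ((l : ℝ) + 1) / max 1 ((m : ℝ) - l) * phiL (l + 1) y) ^ 2) ≤
        2 * c / (m + 1) := by
  have hc := h_c_ge hGT
  have hl0 : (0:ℝ) ≤ l := Nat.cast_nonneg l
  by_cases hm : l + 1 ≤ m
  · refine (hGT m d q hq hm).trans ?_
    have : (1:ℝ) ≤ m := by exact_mod_cast (by omega : 1 ≤ m)
    rw [div_le_div_iff₀ (by linarith) (by linarith)]
    nlinarith
  · have hml : (m:ℝ) ≤ l := by exact_mod_cast (by omega : m ≤ l)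
    have h1 : expect q (fun _ : Fin m → Fin d => (1:ℝ)) = 1 := by
      simp only [_root_.expect, prodProb, mul_one]
      rw [h_sum_prod, hq.2, one_pow]
    have h2 : (1:ℝ) ≤ 2 * c / (m + 1) := by
      rw [le_div_iff₀ (by positivity)]; linarith
    refine le_trans ?_ (h1.le.trans h2)
    unfold _root_.expect
    refine Finset.sum_le_sum fun y _ => mul_le_mul_of_nonneg_left ?_ (h_prodProb_nonneg hq y)
    have hphi : phiL (l + 1) y = 0 := by
      unfold phiL
      rw [Finset.card_eq_zero, Finset.filter_eq_empty_iff]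
      intro i _ hi
      have : cnt y i ≤ m := by
        unfold cnt
        exact (Finset.card_le_univ _).trans (by simp)
      omega
    have hM0 : 0 ≤ massL q l y := Finset.sum_nonneg fun i _ => by
      split_ifs
      · exact hq.1 i
      · exact le_rfl
    have hM1 : massL q l y ≤ 1 := by
      rw [← hq.2]
      refine Finset.sum_le_sum fun i _ => ?_
      split_ifs
      · exact le_rfl
      · exact hq.1 i
    beta_reduce
    rw [hphi]
    simp only [Nat.cast_zero, mul_zero, sub_zero]
    nlinarith

lemma h_term {d n : ℕ} (l : ℕ) (π : Fin d → ℝ) (A : Finset (Fin d)) (S : Finset (Fin n))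
    (x : Fin n → Fin d) (hx : ∀ k, x k ∈ A ↔ k ∈ S) (e : Fin S.card ≃ {k // k ∈ S}) :
    twoLevelErr π l A x ≤
      (massL (fun i => if i ∈ A then π i / ∑ j ∈ A, π j else 0) l (fun j => x (e j)) -
        ((l : ℝ) + 1) / max 1 ((S.card : ℝ) - l) * phiL (l + 1) (fun j => x (e j))) ^ 2 := by
  have hcnt : ∀ i ∈ A, cnt (fun j => x (e j)) i = cnt x i := by
    intro i hi
    unfold cnt
    refine Finset.card_bij (fun j _ => (e j : Fin n)) ?_ ?_ ?_
    · intro j hj; simpa using hj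
    · intro a _ b _ hab; exact e.injective (Subtype.ext hab)
    · intro k hk
      have hk' : x k = i := by simpa using hk
      have hkS : k ∈ S := (hx k).1 (hk' ▸ hi)
      exact ⟨e.symm ⟨k, hkS⟩, by simpa using hk', by simp⟩
  have hset : cntSet x A = S.card := by
    unfold cntSet
    congr 1
    ext k; simp [hx]
  have hM : massL (fun i => if i ∈ A then π i / ∑ j ∈ A, π j else 0) l (fun j => x (e j))
      = massLA π l A x := by
    unfold massL massLA
    rw [← Finset.sum_filter_add_sum_filter_not univ (fun i => i ∈ A)]
    rw [Finset.filter_mem_eq_inter, Finset.univ_inter]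
    rw [Finset.sum_congr rfl (g := fun i => if cnt x i = l then π i / (∑ j ∈ A, π j) else 0),
      Finset.sum_eq_zero (s := univ.filter (fun i => i ∉ A)), add_zero]
    · intro i hi
      simp at hi
      simp [hi]
    · intro i hi
      simp [hi, hcnt i hi]
  have hP : phiL (l + 1) (fun j => x (e j)) = phiLA (l + 1) A x := by
    unfold phiL phiLA
    congr 1
    ext i
    simp only [Finset.mem_filter, Finset.mem_univ, true_and]
    constructor
    · intro h
      have hi : i ∈ A := by
        have : 0 < cnt (fun j => x (e j)) i := by omega
        unfold cnt at this
        obtain ⟨j, hj⟩ := Finset.card_pos.1 this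
        have hj' : x (e j) = i := by simpa using hj
        rw [← hj', hx]; exact (e j).2
      exact ⟨hi, by rw [← hcnt i hi]; exact h⟩
    · rintro ⟨hi, h⟩
      rw [hcnt i hi]; exact h
  rw [hM, hP]
  unfold twoLevelErr
  rw [hset]
  split_ifs with h0
  · positivity
  · have h1 : (1:ℝ) ≤ phiLA l A x := by exact_mod_cast Nat.one_le_iff_ne_zero.2 h0
    rw [← sub_div, div_pow]
    generalize (phiLA l A x : ℝ) = t at h1
    generalize (massLA π l A x - _ : ℝ) = u
    have : t * (u ^ 2 / t ^ 2) = u ^ 2 / t := by field_simp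
    rw [this]
    exact div_le_self (sq_nonneg u) h1

lemma h_split {d n : ℕ} (a b : Fin d → ℝ) (S : Finset (Fin n))
    (e : Fin S.card ≃ {k // k ∈ S}) (H : (Fin S.card → Fin d) → ℝ) :
    ∑ x : Fin n → Fin d, ((∏ k ∈ S, a (x k)) * ∏ k ∈ univ \ S, b (x k)) * H (fun j => x (e j))
      = (∑ y : Fin S.card → Fin d, (∏ j, a (y j)) * H y) * (∑ i, b i) ^ (n - S.card) := by
  have hcard : Fintype.card {k // ¬ k ∈ S} = n - S.card := by
    rw [Fintype.card_subtype_compl]; simp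
  rw [← hcard, ← h_sum_prod]
  rw [← (Equiv.arrowCongr e (Equiv.refl (Fin d))).symm.sum_comp, Finset.sum_mul_sum,
    ← Finset.sum_product', Finset.univ_product_univ]
  rw [← (Equiv.piEquivPiSubtypeProd (fun k => k ∈ S) (fun _ => Fin d)).sum_comp]
  refine Finset.sum_congr rfl fun x _ => ?_
  have h1 : ∏ k ∈ S, a (x k) = ∏ j, a (x (e j)) := by
    rw [e.prod_comp (fun k : {k // k ∈ S} => a (x k))]
    exact (Finset.prod_coe_sort S (fun k => a (x k))).symm
  have h2 : ∏ k ∈ univ \ S, b (x k) = ∏ k : {k // ¬ k ∈ S}, b (x k) :=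
    Finset.prod_subtype _ (by simp) _
  rw [h1, h2]
  simp [Equiv.piEquivPiSubtypeProd, Equiv.arrowCongr, Function.comp_def]
  ring

lemma h_binom (n : ℕ) (p r c : ℝ) (hp : 0 < p) (hr : 0 ≤ r) (hpr : p + r = 1) (hc : 0 < c) :
    ∑ S : Finset (Fin n), p ^ S.card * r ^ (n - S.card) * (2 * c / (S.card + 1))
      ≤ 2 * c / ((n + 1) * p) := by
  have h := Finset.sum_powerset_apply_card (x := (univ : Finset (Fin n)))
    (fun m => p ^ m * r ^ (n - m) * (2 * c / ((m:ℝ) + 1)))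
  rw [Finset.powerset_univ] at h
  rw [h, Finset.card_univ, Fintype.card_fin]
  have hb := add_pow p r (n + 1)
  rw [hpr, one_pow, Finset.sum_range_succ'] at hb
  have h0 : 0 ≤ p ^ 0 * r ^ (n + 1 - 0) * ((n + 1).choose 0 : ℝ) := by positivity
  have hle : ∑ k ∈ range (n + 1), p ^ (k+1) * r ^ (n + 1 - (k+1)) * ((n + 1).choose (k+1) : ℝ) ≤ 1 := by
    linarith
  have : ∑ m ∈ range (n + 1), n.choose m • (p ^ m * r ^ (n - m) * (2 * c / ((m:ℝ) + 1)))
      = (∑ k ∈ range (n + 1), p ^ (k+1) * r ^ (n + 1 - (k+1)) * ((n + 1).choose (k+1) : ℝ)) *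
        (2 * c / ((n + 1) * p)) := by
    rw [Finset.sum_mul]
    refine Finset.sum_congr rfl fun m _ => ?_
    have hch : ((n:ℝ) + 1) * n.choose m = (n + 1).choose (m + 1) * ((m:ℝ) + 1) := by
      exact_mod_cast Nat.add_one_mul_choose_eq n m
    rw [Nat.add_sub_add_right, nsmul_eq_mul]
    have hch' : ((n + 1).choose (m + 1) : ℝ) = ((n:ℝ) + 1) * n.choose m / ((m:ℝ) + 1) := by
      rw [hch]; field_simp
    rw [hch']
    field_simp
    try ring
  rw [this]
  exact mul_le_of_le_one_left (by positivity) hle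

lemma h_main {d n : ℕ} (hn : 1 ≤ n) (l : ℕ) (c : ℝ) (hc : 0 < c)
    (hGT : ∀ (m d' : ℕ) (q : Fin d' → ℝ), IsProbVec q → l + 1 ≤ m →
      expect q (fun y : Fin m → Fin d' =>
          (massL q l y - ((l : ℝ) + 1) / max 1 ((m : ℝ) - l) * phiL (l + 1) y) ^ 2) ≤
        c / m)
    (π : Fin d → ℝ) (hπ : IsProbVec π) (A : Finset (Fin d)) (hApos : 0 < ∑ i ∈ A, π i) :
    expect π (fun x : Fin n → Fin d => twoLevelErr π l A x) ≤
      (8 * l + 2 * c) / n * (1 / ∑ i ∈ A, π i) := by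
  set p := ∑ i ∈ A, π i with hp
  set r := ∑ i ∈ Aᶜ, π i with hr
  have hpr : p + r = 1 := by rw [hp, hr, Finset.sum_add_sum_compl, hπ.2]
  have hr0 : 0 ≤ r := Finset.sum_nonneg fun i _ => hπ.1 i
  let a : Fin d → ℝ := fun i => if i ∈ A then π i else 0
  let b : Fin d → ℝ := fun i => if i ∈ A then 0 else π i
  let q : Fin d → ℝ := fun i => if i ∈ A then π i / p else 0
  have ha0 : ∀ i, 0 ≤ a i := fun i => by simp only [a]; split_ifs; exacts [hπ.1 i, le_rfl]
  have hb0 : ∀ i, 0 ≤ b i := fun i => by simp only [b]; split_ifs; exacts [le_rfl, hπ.1 i]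
  have hbs : ∑ i, b i = r := by
    have h1 : ∑ i, b i + ∑ i, a i = ∑ i, π i := by
      rw [← Finset.sum_add_distrib]
      refine Finset.sum_congr rfl fun i _ => ?_
      simp only [a, b]; split_ifs <;> simp
    have h2 : ∑ i, a i = p := by simp [a, hp, Finset.sum_ite_mem]
    rw [hπ.2, h2] at h1
    linarith
  have hq : IsProbVec q := by
    refine ⟨fun i => ?_, ?_⟩
    · simp only [q]; split_ifs
      · exact div_nonneg (hπ.1 i) hApos.le
      · exact le_rfl
    · simp only [q, Finset.sum_ite_mem, Finset.univ_inter]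
      rw [← Finset.sum_div, ← hp, div_self hApos.ne']
  have haq : ∀ i, a i = p * q i := fun i => by
    simp only [a, q]; split_ifs
    · field_simp
    · simp
  have key : expect π (fun x : Fin n → Fin d => twoLevelErr π l A x) ≤
      ∑ S : Finset (Fin n), p ^ S.card * r ^ (n - S.card) * (2 * c / (S.card + 1)) := by
    have hprod : ∀ x : Fin n → Fin d, prodProb π x =
        ∑ S : Finset (Fin n), (∏ k ∈ S, a (x k)) * ∏ k ∈ univ \ S, b (x k) := by
      intro x
      rw [← Finset.powerset_univ, ← Finset.prod_add]
      refine Finset.prod_congr rfl fun k _ => ?_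
      simp only [a, b]; split_ifs <;> simp
    unfold _root_.expect
    simp only [hprod, Finset.sum_mul]
    rw [Finset.sum_comm]
    refine Finset.sum_le_sum fun S _ => ?_
    let e : Fin S.card ≃ {k // k ∈ S} := S.equivFin.symm
    let H : (Fin S.card → Fin d) → ℝ := fun y =>
      (massL q l y - ((l : ℝ) + 1) / max 1 ((S.card : ℝ) - l) * phiL (l + 1) y) ^ 2
    have step : ∑ x : Fin n → Fin d,
        ((∏ k ∈ S, a (x k)) * ∏ k ∈ univ \ S, b (x k)) * twoLevelErr π l A x ≤
        ∑ x : Fin n → Fin d,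
        ((∏ k ∈ S, a (x k)) * ∏ k ∈ univ \ S, b (x k)) * H (fun j => x (e j)) := by
      refine Finset.sum_le_sum fun x _ => ?_
      by_cases hx : ∀ k, x k ∈ A ↔ k ∈ S
      · refine mul_le_mul_of_nonneg_left (h_term l π A S x hx e) ?_
        exact mul_nonneg (Finset.prod_nonneg fun k _ => ha0 _)
          (Finset.prod_nonneg fun k _ => hb0 _)
      · have hz : (∏ k ∈ S, a (x k)) * ∏ k ∈ univ \ S, b (x k) = 0 := by
          push Not at hx
          obtain ⟨k, hk | hk⟩ := hx
          · rw [Finset.prod_eq_zero (s := univ \ S) (i := k) (by simp [hk.2]) (by simp [b, hk.1]),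
              mul_zero]
          · rw [Finset.prod_eq_zero (s := S) (i := k) hk.2 (by simp [a, hk.1]), zero_mul]
        rw [hz, zero_mul, zero_mul]
    refine step.trans ?_
    rw [h_split a b S e H, hbs]
    have hE : ∑ y : Fin S.card → Fin d, (∏ j, a (y j)) * H y = p ^ S.card * expect q H := by
      unfold _root_.expect prodProb
      rw [Finset.mul_sum]
      refine Finset.sum_congr rfl fun y _ => ?_
      simp only [haq, Finset.prod_mul_distrib, Finset.prod_const, Finset.card_univ,
        Fintype.card_fin]
      ring
    rw [hE]
    have hcond : expect q H ≤ 2 * c / (S.card + 1) := h_cond hGT S.card d q hq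
    calc p ^ S.card * expect q H * r ^ (n - S.card)
        = p ^ S.card * r ^ (n - S.card) * expect q H := by ring
      _ ≤ _ := mul_le_mul_of_nonneg_left hcond (by positivity)
  refine key.trans ((h_binom n p r c hApos hr0 hpr hc).trans ?_)
  have hn' : (0:ℝ) < n := by exact_mod_cast hn
  rw [div_mul_div_comm, mul_one]
  have hl0 : (0:ℝ) ≤ l := Nat.cast_nonneg l
  gcongr
  · linarith
  · linarith

/-- If the Good-Turing estimate has mean squared error at most c_l/m for every
sample size m ≥ l+1, every alphabet and every distribution q, then for a partition of [d]
into nonempty A and B = [d]∖A with π_A, π_B > 0 and l ≤ (n/2)·min(π_A, π_B), the two-level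
estimation errors satisfy
E[φ_l^A·(μ_A − π̂^(l,A))² + φ_l^B·(μ_B − π̂^(l,B))²] ≤ ((8l + 2c_l)/n)·(1/π_A + 1/π_B). -/
theorem stmt_17 {d n : ℕ} (hn : 1 ≤ n) (l : ℕ) (c : ℝ) (hc : 0 < c)
    (hGT : ∀ (m d' : ℕ) (q : Fin d' → ℝ), IsProbVec q → l + 1 ≤ m →
      expect q (fun y : Fin m → Fin d' =>
          (massL q l y - ((l : ℝ) + 1) / max 1 ((m : ℝ) - l) * phiL (l + 1) y) ^ 2) ≤
        c / m)
    (π : Fin d → ℝ) (hπ : IsProbVec π)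
    (A : Finset (Fin d)) (hAne : A.Nonempty) (hBne : Aᶜ.Nonempty)
    (hApos : 0 < ∑ i ∈ A, π i) (hBpos : 0 < ∑ i ∈ Aᶜ, π i)
    (hl : (l : ℝ) ≤ (n : ℝ) / 2 * min (∑ i ∈ A, π i) (∑ i ∈ Aᶜ, π i)) :
    expect π (fun x : Fin n → Fin d => twoLevelErr π l A x + twoLevelErr π l Aᶜ x) ≤
      (8 * l + 2 * c) / n * (1 / ∑ i ∈ A, π i + 1 / ∑ i ∈ Aᶜ, π i) := by
  have hA := h_main hn l c hc hGT π hπ A hApos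
  have hB := h_main hn l c hc hGT π hπ Aᶜ hBpos
  have hs : expect π (fun x : Fin n → Fin d => twoLevelErr π l A x + twoLevelErr π l Aᶜ x) =
      expect π (fun x : Fin n → Fin d => twoLevelErr π l A x) +
      expect π (fun x : Fin n → Fin d => twoLevelErr π l Aᶜ x) := by
    unfold _root_.expect
    simp only [mul_add, Finset.sum_add_distrib]
  rw [hs, mul_add]
  exact add_le_add hA hB
end
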